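/- arXiv:1806.03617 — 2 statements merged into one kernel-verified Lean document; each statement's English description precedes it below -/
import Mathlib

section
/- Let 0 < w_l < w_r, w̃ = w_r − w_l, and let ŵ be the characteristic solution of the Burgers equation with initial data w₀(x) = (w_r + w_l)/2 + (w̃/2)·tanh x. Then for all t ≥ 0 and all x ≤ 0: |ŵ(t,x) − w_l| ≤ w̃·exp(−2(|x| + w_l·t)) and |∂_x ŵ(t,x)| ≤ 2 w̃·exp(−2(|x| + w_l·t)). -/
open Real

/-- Burgers initial data `w₀(x) = (w_r+w_l)/2 + ((w_r-w_l)/2)·tanh x`. -/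
noncomputable def w0 (wl wr x : ℝ) : ℝ :=
  (wr + wl) / 2 + ((wr - wl) / 2) * Real.tanh x

open Classical in
/-- The characteristic solution of Burgers' equation with initial data `w0 wl wr`:
`ŵ(t,x) = w₀(y(t,x))` where `y(t,x)` is the (unique, for `t ≥ 0`) root of
`y + t·w₀(y) = x`. -/
noncomputable def burgersSol (wl wr t x : ℝ) : ℝ :=
  if h : ∃ y : ℝ, y + t * w0 wl wr y = x then w0 wl wr h.choose else 0

theorem w0_eq_exp (wl wr x : ℝ) :
    w0 wl wr x = wl + (wr - wl) * (exp (2 * x) / (exp (2 * x) + 1)) := by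
  have h : exp (2 * x) = exp x * exp x := by rw [← exp_add]; ring_nf
  have hx := exp_pos x
  rw [w0, tanh_eq, h, exp_neg]
  field_simp
  ring

theorem hasDerivAt_w0 (wl wr x : ℝ) :
    HasDerivAt (w0 wl wr) ((wr - wl) * (2 * exp (2 * x) / (exp (2 * x) + 1) ^ 2)) x := by
  have hE : HasDerivAt (fun x : ℝ => exp (2 * x)) (exp (2 * x) * 2) x := by
    simpa using ((hasDerivAt_id x).const_mul 2).exp
  have hne : exp (2 * x) + 1 ≠ 0 := by positivity
  rw [show w0 wl wr = fun x => wl + (wr - wl) * (exp (2 * x) / (exp (2 * x) + 1)) from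
    funext (w0_eq_exp wl wr)]
  refine (((hE.div (hE.add_const 1) hne).const_mul (wr - wl)).const_add wl).congr_deriv ?_
  congr 2
  ring

theorem continuous_w0 (wl wr : ℝ) : Continuous (w0 wl wr) :=
  continuous_iff_continuousAt.2 fun x => (hasDerivAt_w0 wl wr x).continuousAt

theorem monotone_w0 {wl wr : ℝ} (h : wl ≤ wr) : Monotone (w0 wl wr) := by
  have h0 : 0 ≤ wr - wl := sub_nonneg.2 h
  refine monotone_of_deriv_nonneg (fun x => (hasDerivAt_w0 wl wr x).differentiableAt) fun x => ?_
  rw [(hasDerivAt_w0 wl wr x).deriv]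
  positivity

theorem le_w0 {wl wr : ℝ} (h : wl ≤ wr) (x : ℝ) : wl ≤ w0 wl wr x := by
  have h0 : 0 ≤ wr - wl := sub_nonneg.2 h
  rw [w0_eq_exp]
  exact le_add_of_nonneg_right (by positivity)

theorem w0_le {wl wr : ℝ} (h : wl ≤ wr) (x : ℝ) : w0 wl wr x ≤ wr := by
  have h1 : exp (2 * x) / (exp (2 * x) + 1) ≤ 1 :=
    div_le_one_of_le₀ (by linarith) (by positivity)
  rw [w0_eq_exp]
  nlinarith [sub_nonneg.2 h]

theorem w0_sub_le {wl wr : ℝ} (h : wl ≤ wr) (x : ℝ) :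
    w0 wl wr x - wl ≤ (wr - wl) * exp (2 * x) := by
  rw [w0_eq_exp, add_sub_cancel_left]
  exact mul_le_mul_of_nonneg_left
    (div_le_self (exp_pos _).le (by linarith [exp_pos (2 * x)])) (sub_nonneg.2 h)

theorem exists_add_mul_w0_eq {wl wr t : ℝ} (h : wl ≤ wr) (ht : 0 ≤ t) (x : ℝ) :
    ∃ y, y + t * w0 wl wr y = x := by
  have hcont : Continuous fun y => y + t * w0 wl wr y :=
    continuous_id.add (continuous_const.mul (continuous_w0 wl wr))
  have hab : x - t * wr ≤ x - t * wl := by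
    linarith [mul_le_mul_of_nonneg_left h ht]
  obtain ⟨y, -, hy⟩ := intermediate_value_Icc hab hcont.continuousOn
    (show x ∈ Set.Icc _ _ from
      ⟨by linarith [mul_le_mul_of_nonneg_left (w0_le h (x - t * wr)) ht],
       by linarith [mul_le_mul_of_nonneg_left (le_w0 h (x - t * wl)) ht]⟩)
  exact ⟨y, hy⟩

theorem exists_burgersSol_eq {wl wr t : ℝ} (h : wl ≤ wr) (ht : 0 ≤ t) :
    ∃ Y : ℝ → ℝ, (∀ x, Y x + t * w0 wl wr (Y x) = x) ∧
      ∀ x, burgersSol wl wr t x = w0 wl wr (Y x) := by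
  have hex := exists_add_mul_w0_eq h ht
  exact ⟨fun x => (hex x).choose, fun x => (hex x).choose_spec, fun x => dif_pos (hex x)⟩

theorem lipschitzWith_one_of_add_mul_monotone_eq {f Y : ℝ → ℝ} {t : ℝ} (hf : Monotone f)
    (ht : 0 ≤ t) (hY : ∀ x, Y x + t * f (Y x) = x) : LipschitzWith 1 Y := by
  refine LipschitzWith.of_le_add fun x z => ?_
  rw [Real.dist_eq]
  rcases le_total (Y x) (Y z) with h | h
  · linarith [abs_nonneg (x - z)]
  · linarith [mul_le_mul_of_nonneg_left (hf h) ht, hY x, hY z, le_abs_self (x - z)]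

/-- For `0 < w_l < w_r` and `w̃ = w_r - w_l`, the characteristic Burgers solution
satisfies, for all `t ≥ 0` and `x ≤ 0`,
`|ŵ(t,x) - w_l| ≤ w̃ e^{-2(|x| + w_l t)}` and `|∂_x ŵ(t,x)| ≤ 2 w̃ e^{-2(|x| + w_l t)}`. -/
theorem stmt7 (wl wr : ℝ) (hpos : 0 < wl) (hlt : wl < wr) :
    ∀ t : ℝ, 0 ≤ t → ∀ x : ℝ, x ≤ 0 →
      |burgersSol wl wr t x - wl| ≤ (wr - wl) * Real.exp (-2 * (|x| + wl * t)) ∧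
      |deriv (fun ξ => burgersSol wl wr t ξ) x|
        ≤ 2 * (wr - wl) * Real.exp (-2 * (|x| + wl * t)) := by
  intro t ht x hx
  have hw : 0 < wr - wl := sub_pos.2 hlt
  obtain ⟨Y, hY, hsol⟩ := exists_burgersSol_eq hlt.le ht
  have hfoot : exp (2 * Y x) ≤ exp (-2 * (|x| + wl * t)) := by
    rw [exp_le_exp, abs_of_nonpos hx]
    linarith [hY x, mul_le_mul_of_nonneg_left (le_w0 hlt.le (Y x)) ht]
  constructor
  · rw [hsol, abs_of_nonneg (sub_nonneg.2 (le_w0 hlt.le _))]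
    exact (w0_sub_le hlt.le _).trans (mul_le_mul_of_nonneg_left hfoot hw.le)
  · have hw0 := hasDerivAt_w0 wl wr (Y x)
    set E := exp (2 * Y x)
    have hE : 0 < E := exp_pos _
    set D := (wr - wl) * (2 * E / (E + 1) ^ 2)
    have hD0 : 0 ≤ D := by positivity
    have hDle : D ≤ 2 * (wr - wl) * E := by
      have : 2 * E / (E + 1) ^ 2 ≤ 2 * E := div_le_self (by positivity) (by nlinarith)
      linarith [mul_le_mul_of_nonneg_left this hw.le]
    have hden : 1 ≤ 1 + t * D := le_add_of_nonneg_right (by positivity)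
    have hYderiv : HasDerivAt Y (1 + t * D)⁻¹ x :=
      ((hasDerivAt_id _).add (hw0.const_mul t)).of_local_left_inverse
        (lipschitzWith_one_of_add_mul_monotone_eq
          (monotone_w0 hlt.le) ht hY).continuous.continuousAt
        (by positivity) (.of_forall hY)
    have hderiv : HasDerivAt (fun ξ => burgersSol wl wr t ξ) (D * (1 + t * D)⁻¹) x :=
      (hw0.comp x hYderiv).congr_of_eventuallyEq (.of_forall hsol)
    rw [hderiv.deriv, abs_of_nonneg (by positivity)]
    calc D * (1 + t * D)⁻¹ ≤ D := mul_le_of_le_one_right hD0 (inv_le_one_of_one_le₀ hden)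
      _ ≤ 2 * (wr - wl) * E := hDle
      _ ≤ _ := mul_le_mul_of_nonneg_left hfoot (by positivity)
end

section
/- Let w_l < w_r and let ŵ be the characteristic solution of the Burgers equation with initial data w₀(x) = (w_r + w_l)/2 + ((w_r − w_l)/2)·tanh x. Define the rarefaction fan w^r(ξ) = w_l for ξ ≤ w_l, w^r(ξ) = ξ for w_l ≤ ξ ≤ w_r, and w^r(ξ) = w_r for ξ ≥ w_r. Then sup_{x∈ℝ} |ŵ(t,x) − w^r(x/t)| → 0 as t → +∞. -/
open Real

/-- The rarefaction fan `w^r(ξ)`: equals `w_l` for `ξ ≤ w_l`, `ξ` on `[w_l, w_r]`,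
and `w_r` for `ξ ≥ w_r`. -/
noncomputable def riemannFan (wl wr ξ : ℝ) : ℝ := max wl (min ξ wr)

theorem Real.mul_one_sub_tanh_le_one (y : ℝ) : y * (1 - Real.tanh y) ≤ 1 := by
  have hc : 0 < Real.cosh y := Real.cosh_pos y
  have h1 : 1 - Real.tanh y = Real.exp (-y) / Real.cosh y := by
    rw [Real.tanh_eq_sinh_div_cosh, ← Real.cosh_sub_sinh]
    field_simp
  have h2 : y * Real.exp (-y) ≤ 1 := by
    have h3 : y ≤ Real.exp y := by linarith [Real.add_one_le_exp y]
    calc y * Real.exp (-y) ≤ Real.exp y * Real.exp (-y) := by gcongr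
      _ = 1 := by rw [← Real.exp_add]; simp
  rw [h1, ← mul_div_assoc, div_le_one hc]
  exact h2.trans (Real.one_le_cosh y)

theorem w0_mem_Icc {wl wr : ℝ} (h : wl ≤ wr) (y : ℝ) : w0 wl wr y ∈ Set.Icc wl wr := by
  have h1 := Real.tanh_lt_one y
  have h2 := Real.neg_one_lt_tanh y
  unfold w0
  constructor <;> nlinarith

theorem exists_characteristic {wl wr t : ℝ} (h : wl ≤ wr) (ht : 0 ≤ t) (x : ℝ) :
    ∃ y : ℝ, y + t * w0 wl wr y = x := by
  have hcont : Continuous fun y => y + t * w0 wl wr y := by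
    have := continuous_w0 wl wr
    fun_prop
  refine mem_range_of_exists_le_of_exists_ge hcont ⟨x - t * wr, ?_⟩ ⟨x - t * wl, ?_⟩
  · have := mul_le_mul_of_nonneg_left (w0_mem_Icc h (x - t * wr)).2 ht
    linarith
  · have := mul_le_mul_of_nonneg_left (w0_mem_Icc h (x - t * wl)).1 ht
    linarith

theorem abs_w0_sub_riemannFan_le {wl wr t : ℝ} (h : wl ≤ wr) (ht : 0 < t) (y : ℝ) :
    |w0 wl wr y - riemannFan wl wr ((y + t * w0 wl wr y) / t)| ≤ √((wr - wl) / 2 / t) := by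
  obtain ⟨hl, hr⟩ := w0_mem_Icc h y
  have hξ : (y + t * w0 wl wr y) / t = w0 wl wr y + y / t := by field_simp; ring
  rw [hξ]
  apply Real.abs_le_sqrt
  rw [le_div_iff₀ ht]
  have hyt : y / t * t = y := div_mul_cancel₀ y ht.ne'
  rcases le_total 0 y with hy | hy
  · have hq : 0 ≤ y / t := by positivity
    have hd : (wr - w0 wl wr y) * y ≤ (wr - wl) / 2 := by
      have := mul_le_mul_of_nonneg_left (Real.mul_one_sub_tanh_le_one y)
        (show 0 ≤ (wr - wl) / 2 by linarith)
      unfold w0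
      linarith
    have hf : riemannFan wl wr (w0 wl wr y + y / t) = min (w0 wl wr y + y / t) wr :=
      max_eq_right (le_min (by linarith) h)
    rw [hf]
    generalize w0 wl wr y = w at *
    have h1 : 0 ≤ min (w + y / t) wr - w := sub_nonneg.2 (le_min (by linarith) hr)
    have h2 : min (w + y / t) wr - w ≤ y / t := by linarith [min_le_left (w + y / t) wr]
    have h3 : min (w + y / t) wr - w ≤ wr - w := by linarith [min_le_right (w + y / t) wr]
    have h4 := mul_le_mul h3 h2 h1 (by linarith)
    have h5 := mul_le_mul_of_nonneg_right h4 ht.le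
    rw [mul_assoc, mul_assoc, hyt] at h5
    linarith
  · have hq : y / t ≤ 0 := div_nonpos_of_nonpos_of_nonneg hy ht.le
    have hd : (w0 wl wr y - wl) * (-y) ≤ (wr - wl) / 2 := by
      have := mul_le_mul_of_nonneg_left (Real.mul_one_sub_tanh_le_one (-y))
        (show 0 ≤ (wr - wl) / 2 by linarith)
      rw [Real.tanh_neg] at this
      unfold w0
      linarith
    have hf : riemannFan wl wr (w0 wl wr y + y / t) = max wl (w0 wl wr y + y / t) := by
      unfold riemannFan
      rw [min_eq_left (by linarith)]
    rw [hf]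
    generalize w0 wl wr y = w at *
    have h1 : 0 ≤ w - max wl (w + y / t) := sub_nonneg.2 (max_le hl (by linarith))
    have h2 : w - max wl (w + y / t) ≤ -(y / t) := by linarith [le_max_right wl (w + y / t)]
    have h3 : w - max wl (w + y / t) ≤ w - wl := by linarith [le_max_left wl (w + y / t)]
    have h4 := mul_le_mul h3 h2 h1 (by linarith)
    have h5 := mul_le_mul_of_nonneg_right h4 ht.le
    rw [mul_assoc, mul_assoc, neg_mul, hyt] at h5
    linarith

theorem abs_burgersSol_sub_riemannFan_le {wl wr t : ℝ} (h : wl ≤ wr) (ht : 0 < t) (x : ℝ) :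
    |burgersSol wl wr t x - riemannFan wl wr (x / t)| ≤ √((wr - wl) / 2 / t) := by
  have hex := exists_characteristic h ht.le x
  have hy := abs_w0_sub_riemannFan_le h ht hex.choose
  rw [hex.choose_spec] at hy
  rwa [burgersSol, dif_pos hex]

/-- The characteristic Burgers solution converges uniformly in `x`, as `t → ∞`,
to the self-similar rarefaction fan `w^r(x/t)`. -/
theorem stmt9 (wl wr : ℝ) (hlt : wl < wr) :
    Filter.Tendsto
      (fun t : ℝ => ⨆ x : ℝ, |burgersSol wl wr t x - riemannFan wl wr (x / t)|)
      Filter.atTop (nhds 0) := by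
  have hlim : Filter.Tendsto (fun t : ℝ => √((wr - wl) / 2 / t)) Filter.atTop (nhds 0) := by
    have h := (Real.continuous_sqrt.tendsto 0).comp
      (Filter.tendsto_id.const_div_atTop ((wr - wl) / 2))
    rwa [Real.sqrt_zero] at h
  refine tendsto_of_tendsto_of_tendsto_of_le_of_le' tendsto_const_nhds hlim
    (Filter.Eventually.of_forall fun t => Real.iSup_nonneg fun x => abs_nonneg _) ?_
  filter_upwards [Filter.eventually_gt_atTop 0] with t ht
  exact ciSup_le fun x => abs_burgersSol_sub_riemannFan_le hlt.le ht x
end
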